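/- There exist an absolute constant c > 0 and n₀ ∈ ℕ such that for all n ≥ n₀, for every t ≥ 0 and every convex set K ⊆ ℝⁿ (viewed as a ±1-valued function), the Gaussian noise stability satisfies Stab_t(K) ≥ c · e^{−2t}/n². Moreover, if K is additionally centrally symmetric, then Stab_t(K) ≥ c · e^{−2t}/n. -/

import Mathlib

open MeasureTheory ProbabilityTheory

/-- The standard Gaussian measure `N(0,1)ⁿ` on `ℝⁿ`. -/
noncomputable def stdGaussian (n : ℕ) : Measure (EuclideanSpace ℝ (Fin n)) :=
  (Measure.pi fun _ : Fin n => gaussianReal 0 1).map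
    (EuclideanSpace.equiv (Fin n) ℝ).symm

open Classical in
/-- The `±1`-valued function associated to a set `K`. -/
noncomputable def pmInd {n : ℕ} (K : Set (EuclideanSpace ℝ (Fin n)))
    (x : EuclideanSpace ℝ (Fin n)) : ℝ :=
  if x ∈ K then 1 else -1

/-- The Gaussian noise stability
`Stab_t(f) = E[f(x) · f(e^{-t} x + √(1-e^{-2t}) y)]` for independent standard
Gaussian vectors `x, y`. -/
noncomputable def gaussianNoiseStab (n : ℕ) (f : EuclideanSpace ℝ (Fin n) → ℝ)
    (t : ℝ) : ℝ :=
  ∫ x, ∫ y,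
      f x * f (Real.exp (-t) • x + Real.sqrt (1 - Real.exp (-2 * t)) • y)
    ∂(stdGaussian n) ∂(stdGaussian n)

section Gaussian

variable {E : Type*} [NormedAddCommGroup E] [InnerProductSpace ℝ E] [FiniteDimensional ℝ E]
  [MeasurableSpace E] [BorelSpace E]

/-- Rotations preserve the product of two standard Gaussian measures. -/
lemma measurePreserving_rotation (θ : ℝ) :
    MeasurePreserving
      (fun p : E × E => (Real.cos θ • p.1 + Real.sin θ • p.2,
        -Real.sin θ • p.1 + Real.cos θ • p.2))
      ((ProbabilityTheory.stdGaussian E).prod (ProbabilityTheory.stdGaussian E))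
      ((ProbabilityTheory.stdGaussian E).prod (ProbabilityTheory.stdGaussian E)) := by
  refine ⟨by fun_prop, ?_⟩
  have h := IsGaussian.map_rotation_eq_self (μ := ProbabilityTheory.stdGaussian E)
    (by simp) θ
  convert h using 2
  ext p <;> simp [ContinuousLinearMap.rotation_apply]

lemma measurePreserving_neg_stdGaussian :
    MeasurePreserving (fun x : E => -x)
      (ProbabilityTheory.stdGaussian E) (ProbabilityTheory.stdGaussian E) :=
  ⟨by fun_prop, stdGaussian_map (LinearIsometryEquiv.neg ℝ)⟩

lemma exists_angle {c s : ℝ} (h : c ^ 2 + s ^ 2 = 1) :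
    ∃ θ : ℝ, c = Real.cos θ ∧ s = Real.sin θ := by
  refine ⟨Complex.arg ⟨c, s⟩, ?_, ?_⟩
  · have hn : ‖(⟨c, s⟩ : ℂ)‖ = 1 := by
      rw [Complex.norm_def, Complex.normSq_mk, ← sq, ← sq, h, Real.sqrt_one]
    have h0 : (⟨c, s⟩ : ℂ) ≠ 0 := by
      intro h0; rw [h0] at hn; simp at hn
    rw [Complex.cos_arg h0, hn]; simp
  · have hn : ‖(⟨c, s⟩ : ℂ)‖ = 1 := by
      rw [Complex.norm_def, Complex.normSq_mk, ← sq, ← sq, h, Real.sqrt_one]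
    rw [Complex.sin_arg, hn]; simp

/-- The reflection `(x, y) ↦ (c x + s y, s x - c y)` preserves the product of two standard
Gaussian measures. -/
lemma measurePreserving_reflection {c s : ℝ} (h : c ^ 2 + s ^ 2 = 1) :
    MeasurePreserving (fun p : E × E => (c • p.1 + s • p.2, s • p.1 - c • p.2))
      ((ProbabilityTheory.stdGaussian E).prod (ProbabilityTheory.stdGaussian E))
      ((ProbabilityTheory.stdGaussian E).prod (ProbabilityTheory.stdGaussian E)) := by
  obtain ⟨θ, rfl, rfl⟩ := exists_angle h
  have h1 := ((MeasurePreserving.id (ProbabilityTheory.stdGaussian E)).prod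
    (measurePreserving_neg_stdGaussian (E := E))).comp (measurePreserving_rotation (E := E) θ)
  convert h1 using 1
  ext p <;> simp [sub_eq_neg_add]

lemma measurePreserving_combination {c s : ℝ} (h : c ^ 2 + s ^ 2 = 1) :
    MeasurePreserving (fun p : E × E => c • p.1 + s • p.2)
      ((ProbabilityTheory.stdGaussian E).prod (ProbabilityTheory.stdGaussian E))
      (ProbabilityTheory.stdGaussian E) :=
  measurePreserving_fst.comp (measurePreserving_reflection h)

lemma map_inner_stdGaussian (u : E) :
    (ProbabilityTheory.stdGaussian E).map (fun x => inner ℝ u x)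
      = gaussianReal 0 (‖u‖₊ ^ 2) := by
  have h := IsGaussian.map_eq_gaussianReal (μ := ProbabilityTheory.stdGaussian E)
    (innerSL ℝ u)
  rw [integral_strongDual_stdGaussian, variance_dual_stdGaussian, innerSL_apply_norm] at h
  rw [← Real.toNNReal_coe (r := ‖u‖₊ ^ 2)]
  simpa using h

/-- The noise operator with Gaussian noise. -/
noncomputable def noiseOp (c s : ℝ) (f : E → ℝ) (x : E) : ℝ :=
  ∫ y, f (c • x + s • y) ∂(ProbabilityTheory.stdGaussian E)

lemma stronglyMeasurable_noiseOp {f : E → ℝ} (hf : Measurable f) (c s : ℝ) :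
    StronglyMeasurable (noiseOp c s f) := by
  unfold noiseOp
  have : StronglyMeasurable (fun p : E × E => f (c • p.1 + s • p.2)) :=
    (hf.comp (by fun_prop)).stronglyMeasurable
  exact this.integral_prod_right

lemma abs_noiseOp_le {f : E → ℝ} (hb : ∀ x, |f x| ≤ 1) (c s : ℝ) (x : E) :
    |noiseOp c s f x| ≤ 1 := by
  have := norm_integral_le_of_norm_le_const (μ := ProbabilityTheory.stdGaussian E)
    (f := fun y => f (c • x + s • y)) (C := 1) (Filter.Eventually.of_forall fun y => hb _)
  simpa [noiseOp] using this

/-- Self-adjointness of the noise operator. -/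
lemma integral_noiseOp_mul {f g : E → ℝ} (hf : Measurable f) (hb : ∀ x, |f x| ≤ 1)
    (hg : Integrable g (ProbabilityTheory.stdGaussian E)) {c s : ℝ} (h : c ^ 2 + s ^ 2 = 1) :
    ∫ x, noiseOp c s f x * g x ∂(ProbabilityTheory.stdGaussian E)
      = ∫ x, f x * noiseOp c s g x ∂(ProbabilityTheory.stdGaussian E) := by
  set μ := ProbabilityTheory.stdGaussian E with hμ
  have hint : Integrable (fun p : E × E => f (c • p.1 + s • p.2) * g p.1) (μ.prod μ) := by
    refine (hg.comp_fst μ).bdd_mul (c := 1) ?_ (Filter.Eventually.of_forall fun y => hb _)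
    exact (hf.comp (by fun_prop)).aestronglyMeasurable
  have hR := measurePreserving_reflection (E := E) h
  have hint' : Integrable (fun p : E × E => f p.1 * g (c • p.1 + s • p.2)) (μ.prod μ) := by
    have := hR.integrable_comp_of_integrable hint
    refine this.congr (Filter.Eventually.of_forall fun p => ?_)
    simp only [Function.comp]
    congr 2
    simp only [smul_add, smul_sub, smul_smul]
    have : (c * c) • p.1 + (c * s) • p.2 + ((s * s) • p.1 - (s * c) • p.2)
      = (c ^ 2 + s ^ 2) • p.1 := by module
    rw [this, h, one_smul]
  have e1 : ∫ p, f (c • p.1 + s • p.2) * g p.1 ∂(μ.prod μ)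
      = ∫ p : E × E, f p.1 * g (c • p.1 + s • p.2) ∂(μ.prod μ) := by
    have hae := hint.aestronglyMeasurable
    rw [← hR.map_eq] at hae
    rw [← hR.map_eq, integral_map hR.measurable.aemeasurable hae, hR.map_eq]
    refine integral_congr_ae (Filter.Eventually.of_forall fun p => ?_)
    simp only
    congr 2
    simp only [smul_add, smul_sub, smul_smul]
    have : (c * c) • p.1 + (c * s) • p.2 + ((s * s) • p.1 - (s * c) • p.2)
      = (c ^ 2 + s ^ 2) • p.1 := by module
    rw [this, h, one_smul]
  rw [integral_prod _ hint, integral_prod _ hint'] at e1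
  simpa only [noiseOp, integral_mul_const, integral_const_mul] using e1

lemma integrable_of_bound {f : E → ℝ} (hf : Measurable f) (hb : ∀ x, |f x| ≤ 1) :
    Integrable f (ProbabilityTheory.stdGaussian E) :=
  Integrable.of_bound hf.aestronglyMeasurable 1 (Filter.Eventually.of_forall hb)

/-- Semigroup property of the noise operator. -/
lemma noiseOp_noiseOp {f : E → ℝ} (hf : Measurable f) (hb : ∀ x, |f x| ≤ 1)
    {c s b : ℝ} (hbs : b ^ 2 = (c * s) ^ 2 + s ^ 2) (x : E) :
    noiseOp c s (noiseOp c s f) x = noiseOp (c ^ 2) b f x := by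
  set μ := ProbabilityTheory.stdGaussian E with hμ
  have hex : ∃ p q : ℝ, p ^ 2 + q ^ 2 = 1 ∧ b * p = c * s ∧ b * q = s := by
    by_cases hb0 : b = 0
    · have hs : s = 0 := by nlinarith [sq_nonneg (c * s), sq_nonneg s]
      exact ⟨1, 0, by norm_num, by simp [hb0, hs], by simp [hs]⟩
    · refine ⟨c * s / b, s / b, ?_, by field_simp, by field_simp⟩
      rw [div_pow, div_pow, ← add_div, ← hbs, div_self (pow_ne_zero 2 hb0)]
  obtain ⟨p, q, hpq, hp, hq⟩ := hex
  have hT := measurePreserving_combination (E := E) hpq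
  unfold noiseOp
  have hm : Measurable fun w : E => f (c ^ 2 • x + b • w) := hf.comp (by fun_prop)
  conv_rhs => rw [← hT.map_eq]
  rw [integral_map hT.measurable.aemeasurable hm.aestronglyMeasurable, integral_prod]
  · refine integral_congr_ae (Filter.Eventually.of_forall fun y => ?_)
    refine integral_congr_ae (Filter.Eventually.of_forall fun z => ?_)
    simp only
    congr 1
    rw [smul_add b, smul_smul, smul_smul, hp, hq]
    module
  · exact Integrable.of_bound (hm.comp hT.measurable).aestronglyMeasurable 1
      (Filter.Eventually.of_forall fun _ => hb _)

/-- A lower bound for the noise stability in terms of the correlation with an eigenfunction of the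
noise operator. -/
lemma sq_le_noise_stability_mul {f g : E → ℝ} (hf : Measurable f) (hb : ∀ x, |f x| ≤ 1)
    (hg : MemLp g 2 (ProbabilityTheory.stdGaussian E))
    {c s b l : ℝ} (h : c ^ 2 + s ^ 2 = 1) (hbs : b ^ 2 = (c * s) ^ 2 + s ^ 2)
    (hgl : ∀ x, noiseOp c s g x = l * g x) :
    (l * ∫ x, f x * g x ∂(ProbabilityTheory.stdGaussian E)) ^ 2
      ≤ (∫ x, f x * noiseOp (c ^ 2) b f x ∂(ProbabilityTheory.stdGaussian E)) *
        ∫ x, g x ^ 2 ∂(ProbabilityTheory.stdGaussian E) := by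
  set μ := ProbabilityTheory.stdGaussian E with hμ
  set F := noiseOp c s f with hF
  have hFm : StronglyMeasurable F := stronglyMeasurable_noiseOp hf c s
  have hFb : ∀ x, |F x| ≤ 1 := abs_noiseOp_le hb c s
  have e1 : ∫ x, f x * noiseOp (c ^ 2) b f x ∂μ = ∫ x, F x ^ 2 ∂μ := by
    simp_rw [← noiseOp_noiseOp hf hb hbs]
    rw [← integral_noiseOp_mul hf hb (integrable_of_bound hFm.measurable hFb) h]
    simp only [sq, hF, hμ]
  have hgi : Integrable g μ := hg.integrable (by norm_num)
  have e2 : l * ∫ x, f x * g x ∂μ = ∫ x, F x * g x ∂μ := by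
    rw [integral_noiseOp_mul hf hb hgi h, ← integral_const_mul]
    refine integral_congr_ae (Filter.Eventually.of_forall fun x => ?_)
    simp only [hgl]; ring
  rw [e1, e2]
  have i1 : Integrable (fun x => F x ^ 2) μ :=
    Integrable.of_bound (hFm.aestronglyMeasurable.pow 2) 1 (Filter.Eventually.of_forall fun x => by
      rw [Real.norm_eq_abs, abs_pow]; exact pow_le_one₀ (abs_nonneg _) (hFb x))
  have i2 : Integrable (fun x => F x * g x) μ :=
    hgi.bdd_mul (c := 1) hFm.aestronglyMeasurable (Filter.Eventually.of_forall hFb)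
  have i3 : Integrable (fun x => g x ^ 2) μ := hg.integrable_sq
  have key : ∀ r : ℝ, 0 ≤ (∫ x, g x ^ 2 ∂μ) * (r * r) + (-2 * ∫ x, F x * g x ∂μ) * r
      + ∫ x, F x ^ 2 ∂μ := by
    intro r
    have : 0 ≤ ∫ x, (F x - r * g x) ^ 2 ∂μ := integral_nonneg fun x => sq_nonneg _
    have e : ∀ x, (F x - r * g x) ^ 2
        = F x ^ 2 + ((-2 * r) * (F x * g x) + (r * r) * g x ^ 2) := fun x => by ring
    simp_rw [e] at this
    have i23 : Integrable (fun x => (-2 * r) * (F x * g x) + (r * r) * g x ^ 2) μ :=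
      (i2.const_mul _).add (i3.const_mul _)
    rw [integral_add i1 i23, integral_add (i2.const_mul _) (i3.const_mul _), integral_const_mul,
      integral_const_mul] at this
    linarith
  have := discrim_le_zero key
  rw [discrim] at this
  nlinarith

end Gaussian

section Density

variable {E : Type*} [NormedAddCommGroup E] [InnerProductSpace ℝ E]

/-- The density of the standard Gaussian measure. -/
noncomputable def gaussDensity (x : E) : ℝ :=
  ((2 * Real.pi) ^ (Module.finrank ℝ E / 2 : ℝ))⁻¹ * Real.exp (-‖x‖ ^ 2 / 2)

lemma gaussDensity_nonneg (x : E) : 0 ≤ gaussDensity x := by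
  unfold gaussDensity; positivity

lemma measurable_gaussDensity [MeasurableSpace E] [BorelSpace E] :
    Measurable (gaussDensity (E := E)) := by
  unfold gaussDensity; fun_prop

variable [FiniteDimensional ℝ E] [MeasurableSpace E] [BorelSpace E]

lemma charFun_withDensity_gaussian (t : E) :
    ∫ x : E, Real.exp (-‖x‖ ^ 2 / 2) • Complex.exp (inner ℝ x t * Complex.I)
      = ((2 * Real.pi) ^ (Module.finrank ℝ E / 2 : ℝ) : ℝ) * Complex.exp (-‖t‖ ^ 2 / 2) := by
  have h := GaussianFourier.integral_cexp_neg_mul_sq_norm_add (V := E) (b := 1 / 2)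
    (by norm_num) Complex.I t
  have e : ∀ x : E, Real.exp (-‖x‖ ^ 2 / 2) • Complex.exp (inner ℝ x t * Complex.I)
      = Complex.exp (-(1 / 2) * ‖x‖ ^ 2 + Complex.I * inner ℝ t x) := fun x => by
    rw [Complex.exp_add, Complex.real_smul, Complex.ofReal_exp, real_inner_comm]
    push_cast
    congr 2 <;> ring
  simp_rw [e]
  rw [h]
  congr 1
  · rw [Complex.ofReal_cpow (by positivity)]
    push_cast
    congr 1
    field_simp
  · rw [Complex.I_sq]; congr 1; field_simp; norm_num

lemma integrable_exp_neg_sq : Integrable (fun x : E => Real.exp (-‖x‖ ^ 2 / 2)) := by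
  have h := (GaussianFourier.integrable_cexp_neg_mul_sq_norm_add (V := E) (b := 1 / 2)
    (by norm_num) 0 0).norm
  refine h.congr (Filter.Eventually.of_forall fun x => ?_)
  simp only [Complex.norm_exp]
  congr 1
  have : (-(1 / 2 : ℂ) * (‖x‖ : ℂ) ^ 2 + 0 * (inner ℝ (0 : E) x : ℂ))
    = ((-‖x‖ ^ 2 / 2 : ℝ) : ℂ) := by push_cast; ring
  rw [this, Complex.ofReal_re]

lemma integral_withDensity_gaussDensity {F : Type*} [NormedAddCommGroup F] [NormedSpace ℝ F]
    (g : E → F) :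
    ∫ x, g x ∂(volume.withDensity fun x : E => ENNReal.ofReal (gaussDensity x))
      = ∫ x, gaussDensity x • g x := by
  rw [integral_withDensity_eq_integral_toReal_smul (by
    exact measurable_gaussDensity.ennreal_ofReal) (by simp)]
  simp_rw [ENNReal.toReal_ofReal (gaussDensity_nonneg _)]

lemma stdGaussian_eq_withDensity :
    ProbabilityTheory.stdGaussian E
      = volume.withDensity fun x : E => ENNReal.ofReal (gaussDensity x) := by
  have : IsFiniteMeasure (volume.withDensity fun x : E => ENNReal.ofReal (gaussDensity x)) :=
    isFiniteMeasure_withDensity_ofReal (integrable_exp_neg_sq.const_mul _).2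
  refine Measure.ext_of_charFun ?_
  ext t
  rw [charFun_stdGaussian, charFun_apply, integral_withDensity_gaussDensity]
  simp_rw [gaussDensity, mul_smul]
  rw [integral_smul, charFun_withDensity_gaussian, Complex.real_smul, ← mul_assoc,
    ← Complex.ofReal_mul, inv_mul_cancel₀ (by positivity)]
  simp

lemma stdGaussian_absolutelyContinuous : ProbabilityTheory.stdGaussian E ≪ volume := by
  rw [stdGaussian_eq_withDensity]
  exact withDensity_absolutelyContinuous _ _

/-- The Gaussian measure of a dilate, as an integral over the original set. -/
lemma stdGaussian_real_dilate {K : Set E} (hK : MeasurableSet K) (a : ℝ) :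
    (ProbabilityTheory.stdGaussian E).real {z | Real.exp (-a) • z ∈ K}
      = ∫ x in K, Real.exp (a * Module.finrank ℝ E - (Real.exp (2 * a) - 1) * ‖x‖ ^ 2 / 2)
          ∂(ProbabilityTheory.stdGaussian E) := by
  have hm : MeasurableSet {z : E | Real.exp (-a) • z ∈ K} :=
    hK.preimage (measurable_const_smul (Real.exp (-a)))
  rw [← integral_indicator_one hm, ← integral_indicator hK, stdGaussian_eq_withDensity,
    integral_withDensity_gaussDensity, integral_withDensity_gaussDensity]
  have h := Measure.integral_comp_smul (volume : Measure E)
    (fun x : E => gaussDensity x • ({z | Real.exp (-a) • z ∈ K}.indicator 1 x : ℝ)) (Real.exp a)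
  rw [smul_eq_mul, abs_of_nonneg (by positivity), eq_inv_mul_iff_mul_eq₀ (by positivity)] at h
  rw [← h, ← integral_const_mul]
  refine integral_congr_ae (Filter.Eventually.of_forall fun x => ?_)
  have e : Real.exp (-a) • Real.exp a • x = x := by
    rw [smul_smul, ← Real.exp_add]; simp
  by_cases hx : x ∈ K
  · simp only [Set.indicator, Set.mem_ofPred_eq, e, hx, if_true, Pi.one_apply, smul_eq_mul, mul_one,
      gaussDensity, norm_smul, Real.norm_eq_abs, Real.abs_exp]
    rw [mul_left_comm, mul_assoc, ← Real.exp_nat_mul, ← Real.exp_add, ← Real.exp_add, mul_pow,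
      ← Real.exp_nat_mul]
    congr 2
    push_cast
    ring
  · simp [Set.indicator, e, hx]

lemma exp_le_quadratic {u N : ℝ} (hN : 0 ≤ N) (hu : u ≤ N) :
    Real.exp u ≤ 1 + u + u ^ 2 * Real.exp N := by
  have h1 : 1 ≤ Real.exp N := Real.one_le_exp hN
  have h2 : u ^ 2 ≤ u ^ 2 * Real.exp N := le_mul_of_one_le_right (sq_nonneg _) h1
  rcases lt_or_ge u (-1) with h | h
  · have : Real.exp u ≤ 1 := Real.exp_le_one_iff.2 (by linarith)
    nlinarith
  rcases le_or_gt u 1 with h' | h'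
  · have := Real.abs_exp_sub_one_sub_id_le (abs_le.2 ⟨h, h'⟩)
    linarith [le_abs_self (Real.exp u - 1 - u)]
  · have h3 : Real.exp u ≤ Real.exp N := Real.exp_le_exp.2 hu
    nlinarith [mul_le_mul_of_nonneg_right (one_le_pow₀ h'.le : 1 ≤ u ^ 2) (Real.exp_nonneg N)]

end Density

section Moments

/-- The variance of the square of a standard Gaussian variable. -/
noncomputable def varSq : ℝ := Var[fun t : ℝ => t ^ 2; gaussianReal 0 1]

lemma memLp_sq_gaussianReal : MemLp (fun t : ℝ => t ^ 2) 2 (gaussianReal 0 1) := by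
  have h := (memLp_id_gaussianReal' (μ := 0) (v := 1) 4 (by norm_num))
  have h2 := h.norm_rpow_div 2
  have e : (4 : ENNReal) / 2 = 2 := by
    rw [show (4 : ENNReal) = 2 * 2 by norm_num, mul_div_assoc, ENNReal.div_self] <;> norm_num
  rw [e] at h2
  refine h2.congr_norm (by fun_prop) (Filter.Eventually.of_forall fun x => by simp)

lemma integral_sq_gaussianReal : ∫ t, t ^ 2 ∂(gaussianReal 0 1) = 1 := by
  have h := variance_id_gaussianReal (μ := 0) (v := 1)
  rw [variance_eq_integral (by fun_prop)] at h
  simpa using h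

lemma stdGaussian_eq_map (n : ℕ) :
    ProbabilityTheory.stdGaussian (EuclideanSpace ℝ (Fin n))
      = (Measure.pi fun _ : Fin n => gaussianReal 0 1).map (WithLp.toLp 2) :=
  map_pi_eq_stdGaussian.symm

lemma stdGaussian_eq_stdGaussian (n : ℕ) :
    _root_.stdGaussian n = ProbabilityTheory.stdGaussian (EuclideanSpace ℝ (Fin n)) := by
  rw [stdGaussian_eq_map]
  rfl

lemma integral_norm_sq (n : ℕ) :
    ∫ x, ‖x‖ ^ 2 ∂(ProbabilityTheory.stdGaussian (EuclideanSpace ℝ (Fin n))) = n := by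
  rw [stdGaussian_eq_map, integral_map (by fun_prop) (by fun_prop)]
  simp_rw [EuclideanSpace.real_norm_sq_eq]
  rw [integral_finsetSum]
  · have : ∀ i : Fin n, ∫ x : Fin n → ℝ, (x i) ^ 2 ∂(Measure.pi fun _ => gaussianReal 0 1) = 1 :=
      fun i => by
        rw [integral_comp_eval (μ := fun _ : Fin n => gaussianReal 0 1) (i := i)
          (f := fun t : ℝ => t ^ 2) (by fun_prop), integral_sq_gaussianReal]
    simp [this]
  · intro i _
    exact integrable_comp_eval (μ := fun _ : Fin n => gaussianReal 0 1) (i := i)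
          (f := fun t : ℝ => t ^ 2) (memLp_sq_gaussianReal.integrable (by norm_num))

lemma memLp_norm_sq (n : ℕ) : MemLp (fun x => ‖x‖ ^ 2 - (n : ℝ)) 2
    (ProbabilityTheory.stdGaussian (EuclideanSpace ℝ (Fin n))) := by
  refine MemLp.sub ?_ (memLp_const _)
  have h := IsGaussian.memLp_id (ProbabilityTheory.stdGaussian (EuclideanSpace ℝ (Fin n)))
    4 (by norm_num)
  have h2 := h.norm_rpow_div 2
  have e : (4 : ENNReal) / 2 = 2 := by
    rw [show (4 : ENNReal) = 2 * 2 by norm_num, mul_div_assoc, ENNReal.div_self] <;> norm_num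
  rw [e] at h2
  refine h2.congr_norm (by fun_prop) (Filter.Eventually.of_forall fun x => by simp)

lemma integral_norm_sq_sub_sq (n : ℕ) :
    ∫ x, (‖x‖ ^ 2 - (n : ℝ)) ^ 2 ∂(ProbabilityTheory.stdGaussian (EuclideanSpace ℝ (Fin n)))
      = n * varSq := by
  have h : Var[fun x => ‖x‖ ^ 2; ProbabilityTheory.stdGaussian (EuclideanSpace ℝ (Fin n))]
      = ∫ x, (‖x‖ ^ 2 - (n : ℝ)) ^ 2
        ∂(ProbabilityTheory.stdGaussian (EuclideanSpace ℝ (Fin n))) := by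
    rw [variance_eq_integral (by fun_prop), integral_norm_sq]
  rw [← h, stdGaussian_eq_map, variance_map (by fun_prop) (by fun_prop)]
  have e : ((fun x : EuclideanSpace ℝ (Fin n) => ‖x‖ ^ 2) ∘ WithLp.toLp 2)
      = ∑ i, fun x : Fin n → ℝ => (fun t : ℝ => t ^ 2) (x i) := by
    ext x
    simp [EuclideanSpace.real_norm_sq_eq]
  rw [e, variance_sum_pi fun i => memLp_sq_gaussianReal]
  simp [varSq]

end Moments

section Dilate

/-- A quadratic upper bound for the growth of the Gaussian measure of dilates. -/
lemma stdGaussian_real_dilate_sub_le {n : ℕ} {K : Set (EuclideanSpace ℝ (Fin n))}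
    (hK : MeasurableSet K) {a : ℝ} (ha : 0 ≤ a) :
    (ProbabilityTheory.stdGaussian (EuclideanSpace ℝ (Fin n))).real {z | Real.exp (-a) • z ∈ K}
        - (ProbabilityTheory.stdGaussian (EuclideanSpace ℝ (Fin n))).real K
      ≤ a * |∫ x in K, (‖x‖ ^ 2 - (n : ℝ))
            ∂(ProbabilityTheory.stdGaussian (EuclideanSpace ℝ (Fin n)))|
        + a ^ 2 * (1 + Real.exp n * (n * varSq)) := by
  set μ := ProbabilityTheory.stdGaussian (EuclideanSpace ℝ (Fin n)) with hμ
  have hV : 0 ≤ varSq := variance_nonneg _ _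
  rcases le_or_gt 1 a with h1 | h1
  · have : μ.real {z | Real.exp (-a) • z ∈ K} ≤ 1 := measureReal_le_one
    have h2 : 0 ≤ μ.real K := measureReal_nonneg
    have h3 : 1 ≤ a ^ 2 := one_le_pow₀ h1
    have h4 : 0 ≤ a ^ 2 * (Real.exp n * (n * varSq)) := by positivity
    have h5 := mul_nonneg ha (abs_nonneg (∫ x in K, (‖x‖ ^ 2 - (n : ℝ)) ∂μ))
    linarith
  rw [stdGaussian_real_dilate hK, finrank_euclideanSpace_fin]
  have hL := memLp_norm_sq n
  have i1 : Integrable (fun x => ‖x‖ ^ 2 - (n : ℝ)) μ := hL.integrable (by norm_num)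
  have i2 : Integrable (fun x => (‖x‖ ^ 2 - (n : ℝ)) ^ 2) μ := hL.integrable_sq
  have hpt : ∀ x : EuclideanSpace ℝ (Fin n),
      Real.exp (a * n - (Real.exp (2 * a) - 1) * ‖x‖ ^ 2 / 2)
        ≤ 1 + (-a * (‖x‖ ^ 2 - n) + a ^ 2 * Real.exp n * (‖x‖ ^ 2 - n) ^ 2) := fun x => by
    have h2 : a * n - (Real.exp (2 * a) - 1) * ‖x‖ ^ 2 / 2 ≤ -a * (‖x‖ ^ 2 - n) := by
      nlinarith [Real.add_one_le_exp (2 * a), sq_nonneg ‖x‖]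
    have h3 : -a * (‖x‖ ^ 2 - n) ≤ n := by
      nlinarith [mul_nonneg ha (sq_nonneg ‖x‖), (Nat.cast_nonneg n : (0 : ℝ) ≤ n)]
    have := exp_le_quadratic (Nat.cast_nonneg n) h3
    nlinarith [Real.exp_le_exp.2 h2]
  have i3 : Integrable (fun x : EuclideanSpace ℝ (Fin n) =>
      -a * (‖x‖ ^ 2 - n) + a ^ 2 * Real.exp n * (‖x‖ ^ 2 - n) ^ 2) μ :=
    (i1.const_mul _).add (i2.const_mul _)
  have h4 : ∫ x in K, Real.exp (a * n - (Real.exp (2 * a) - 1) * ‖x‖ ^ 2 / 2) ∂μ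
      ≤ ∫ x in K, (1 + (-a * (‖x‖ ^ 2 - n) + a ^ 2 * Real.exp n * (‖x‖ ^ 2 - n) ^ 2)) ∂μ :=
    integral_mono_of_nonneg (Filter.Eventually.of_forall fun x => Real.exp_nonneg _)
      ((integrable_const _).add i3).integrableOn (Filter.Eventually.of_forall hpt)
  rw [integral_add (integrable_const _).integrableOn i3.integrableOn,
    integral_add (i1.const_mul _).integrableOn (i2.const_mul _).integrableOn,
    integral_const_mul, integral_const_mul] at h4
  have h5 : ∫ x in K, (‖x‖ ^ 2 - (n : ℝ)) ^ 2 ∂μ ≤ n * varSq := by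
    rw [← integral_norm_sq_sub_sq]
    exact setIntegral_le_integral i2 (Filter.Eventually.of_forall fun x => sq_nonneg _)
  have h6 : ∫ _ in K, (1 : ℝ) ∂μ = μ.real K := by simp
  rw [h6] at h4
  have h7 := mul_le_mul_of_nonneg_left h5 (by positivity : 0 ≤ a ^ 2 * Real.exp n)
  have h8 := mul_le_mul_of_nonneg_left (neg_abs_le (∫ x in K, (‖x‖ ^ 2 - (n : ℝ)) ∂μ)) ha
  nlinarith [sq_nonneg a]

end Dilate

section Isoperimetry

variable {E : Type*} [NormedAddCommGroup E] [InnerProductSpace ℝ E] [FiniteDimensional ℝ E]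

/-- A supporting functional of a closed convex body at the radial projection of a point. -/
lemma exists_support_vector {K : Set E} (hK : Convex ℝ K) {w : ℝ} (hw : 0 < w)
    (hball : Metric.closedBall (0 : E) w ⊆ K) {z : E} (hz : 1 ≤ gauge K z) :
    ∃ v : E, ‖v‖ ≤ 1 / w ∧ (∀ k ∈ K, inner ℝ v k ≤ 1) ∧ inner ℝ v z = gauge K z := by
  have hnhds : K ∈ nhds (0 : E) := Filter.mem_of_superset (Metric.closedBall_mem_nhds 0 hw) hball
  have habs : Absorbent ℝ K := absorbent_nhds_zero hnhds
  have h0K : (0 : E) ∈ K := mem_of_mem_nhds hnhds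
  set r := gauge K z with hr
  have hr0 : 0 < r := by linarith
  have hconv : Convex ℝ {x | gauge K x < r} := by
    intro x hx y hy a b ha hb hab
    have hx' : gauge K x < r := hx
    have hy' : gauge K y < r := hy
    change gauge K (a • x + b • y) < r
    have h1 := gauge_add_le hK habs (a • x) (b • y)
    rw [gauge_smul_of_nonneg ha, gauge_smul_of_nonneg hb, smul_eq_mul, smul_eq_mul] at h1
    rcases ha.eq_or_lt with rfl | ha'
    · have : b = 1 := by linarith
      subst this
      linarith
    · have h2 := mul_lt_mul_of_pos_left hx' ha'
      have h3 := mul_le_mul_of_nonneg_left hy'.le hb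
      have h4 : a * r + b * r = r := by rw [← add_mul, hab, one_mul]
      linarith
  obtain ⟨f, hf⟩ := geometric_hahn_banach_open_point (s := {x | gauge K x < r}) (x := z)
    hconv (isOpen_lt (continuous_gauge hK hnhds) continuous_const)
    (by simp [← hr])
  have hfz : 0 < f z := by simpa using hf 0 (by simpa using hr0)
  have hk : ∀ k ∈ K, r * f k ≤ f z := by
    intro k hk
    have hg : gauge K k ≤ 1 := gauge_le_one_of_mem hk
    have : ∀ θ : ℝ, θ ∈ Set.Ico (0 : ℝ) 1 → θ * (r * f k) ≤ f z := by
      intro θ hθ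
      have := hf ((θ * r) • k) (by
        change gauge K ((θ * r) • k) < r
        rw [gauge_smul_of_nonneg (mul_nonneg hθ.1 hr0.le), smul_eq_mul]
        nlinarith [mul_le_mul_of_nonneg_left hg (mul_nonneg hθ.1 hr0.le), hθ.2])
      rw [map_smul, smul_eq_mul] at this
      linarith
    by_contra! hlt
    have h1 : f z / (r * f k) < 1 := (div_lt_one (by linarith)).2 hlt
    have h2 : 0 < f z / (r * f k) := div_pos hfz (by linarith)
    have := this ((f z / (r * f k) + 1) / 2) ⟨by linarith, by linarith⟩
    have h3 : f z / (r * f k) * (r * f k) = f z := div_mul_cancel₀ _ (by linarith)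
    nlinarith
  refine ⟨(r / f z) • (InnerProductSpace.toDual ℝ E).symm f, ?_, ?_, ?_⟩
  · set v := (r / f z) • (InnerProductSpace.toDual ℝ E).symm f with hv
    by_cases hv0 : v = 0
    · rw [hv0]; simp [hw.le]
    have hvn : 0 < ‖v‖ := norm_pos_iff.2 hv0
    have hmem : (w / ‖v‖) • v ∈ K := hball (by
      rw [mem_closedBall_zero_iff, norm_smul, Real.norm_eq_abs, abs_of_pos (by positivity)]
      field_simp; rfl)
    have h1 := hk _ hmem
    have h2 : f v = (f z / r) * ‖v‖ ^ 2 := by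
      rw [← real_inner_self_eq_norm_sq]
      conv_rhs => rw [hv, real_inner_smul_left, InnerProductSpace.toDual_symm_apply, ← hv]
      field_simp
    rw [map_smul, h2, smul_eq_mul] at h1
    rw [le_div_iff₀ hw]
    have h3 : r * (w / ‖v‖ * (f z / r * ‖v‖ ^ 2)) = (‖v‖ * w) * f z := by field_simp
    rw [h3] at h1
    nlinarith
  · intro k hkK
    rw [real_inner_smul_left, InnerProductSpace.toDual_symm_apply, div_mul_eq_mul_div,
      div_le_one hfz]
    exact hk k hkK
  · rw [real_inner_smul_left, InnerProductSpace.toDual_symm_apply, div_mul_cancel₀ _ hfz.ne']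

variable [MeasurableSpace E] [BorelSpace E]

lemma measure_step_le {K : Set E} (hK : Convex ℝ K) {w : ℝ} (hw : 0 < w)
    (hball : Metric.closedBall (0 : E) w ⊆ K) {z : E} (hz : 1 ≤ gauge K z) (c : ℝ) {s : ℝ}
    (hs : 0 ≤ s) :
    ProbabilityTheory.stdGaussian E {y | c • z + s • y ∈ K}
      ≤ gaussianReal 0 1 {g : ℝ | c * gauge K z ≤ 1 + s * |g| / w} := by
  obtain ⟨v, hv, hvK, hvz⟩ := exists_support_vector hK hw hball hz
  have hm : MeasurableSet {t : ℝ | c * gauge K z + s * t ≤ 1} :=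
    measurableSet_le (by fun_prop) (by fun_prop)
  calc ProbabilityTheory.stdGaussian E {y | c • z + s • y ∈ K}
      ≤ ProbabilityTheory.stdGaussian E
          ((fun y => inner ℝ v y) ⁻¹' {t : ℝ | c * gauge K z + s * t ≤ 1}) := by
        refine measure_mono fun y hy => ?_
        have := hvK _ hy
        rw [inner_add_right, real_inner_smul_right, real_inner_smul_right, hvz] at this
        exact this
    _ = gaussianReal 0 (‖v‖₊ ^ 2) {t : ℝ | c * gauge K z + s * t ≤ 1} := by
        rw [← map_inner_stdGaussian, Measure.map_apply (by fun_prop) hm]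
    _ = gaussianReal 0 1 ((fun g => ‖v‖ * g) ⁻¹' {t : ℝ | c * gauge K z + s * t ≤ 1}) := by
        rw [← Measure.map_apply (by fun_prop) hm, gaussianReal_map_const_mul]
        congr 2
        · simp
        · ext; simp
    _ ≤ _ := by
        refine measure_mono fun g hg => ?_
        have hg' : c * gauge K z + s * (‖v‖ * g) ≤ 1 := hg
        change c * gauge K z ≤ 1 + s * |g| / w
        have h1 : -(‖v‖ * g) ≤ |g| / w := by
          calc -(‖v‖ * g) = ‖v‖ * (-g) := by ring
            _ ≤ ‖v‖ * |g| := mul_le_mul_of_nonneg_left (neg_le_abs g) (norm_nonneg v)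
            _ ≤ 1 / w * |g| := mul_le_mul_of_nonneg_right hv (abs_nonneg g)
            _ = |g| / w := by ring
        have h2 := mul_le_mul_of_nonneg_left h1 hs
        rw [mul_div_assoc]
        linarith

/-- Interpolating between two independent Gaussian vectors by small rotations. -/
lemma measure_prod_compl_le (K : Set E) (hK : MeasurableSet K) (N : ℕ) (δ : ℝ)
    (hδ : N * δ = Real.pi / 2) :
    ((ProbabilityTheory.stdGaussian E).prod (ProbabilityTheory.stdGaussian E)) (K ×ˢ Kᶜ)
      ≤ N * ((ProbabilityTheory.stdGaussian E).prod (ProbabilityTheory.stdGaussian E))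
        {p : E × E | p.1 ∉ K ∧ Real.cos δ • p.1 + Real.sin δ • p.2 ∈ K} := by
  set μ := ProbabilityTheory.stdGaussian E with hμ
  have hm1 : MeasurableSet {p : E × E | p.1 ∉ K ∧ Real.cos δ • p.1 + Real.sin δ • p.2 ∈ K} :=
    (hK.compl.preimage measurable_fst).inter
      (hK.preimage (f := fun p : E × E => Real.cos δ • p.1 + Real.sin δ • p.2) (by fun_prop))
  have hm2 : MeasurableSet {p : E × E | p.1 ∈ K ∧ Real.cos δ • p.1 + Real.sin δ • p.2 ∉ K} :=
    (hK.preimage measurable_fst).inter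
      (hK.compl.preimage (f := fun p : E × E => Real.cos δ • p.1 + Real.sin δ • p.2)
        (by fun_prop))
  have hswap : (μ.prod μ) {p : E × E | p.1 ∈ K ∧ Real.cos δ • p.1 + Real.sin δ • p.2 ∉ K}
      = (μ.prod μ) {p : E × E | p.1 ∉ K ∧ Real.cos δ • p.1 + Real.sin δ • p.2 ∈ K} := by
    have hR := measurePreserving_reflection (E := E) (Real.cos_sq_add_sin_sq δ)
    rw [← hR.measure_preimage hm1.nullMeasurableSet]
    congr 1
    ext p
    have e : Real.cos δ • (Real.cos δ • p.1 + Real.sin δ • p.2)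
        + Real.sin δ • (Real.sin δ • p.1 - Real.cos δ • p.2) = p.1 := by
      calc _ = (Real.cos δ ^ 2 + Real.sin δ ^ 2) • p.1 := by module
        _ = p.1 := by rw [Real.cos_sq_add_sin_sq, one_smul]
    simp only [Set.mem_preimage, Set.mem_ofPred_eq, e]
    exact and_comm
  have hrot : ∀ i : ℕ, (μ.prod μ)
      {p : E × E | Real.cos (i * δ) • p.1 + Real.sin (i * δ) • p.2 ∈ K ∧
        Real.cos ((i + 1 : ℕ) * δ) • p.1 + Real.sin ((i + 1 : ℕ) * δ) • p.2 ∉ K}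
      = (μ.prod μ) {p : E × E | p.1 ∈ K ∧ Real.cos δ • p.1 + Real.sin δ • p.2 ∉ K} := by
    intro i
    rw [← (measurePreserving_rotation (E := E) (i * δ)).measure_preimage hm2.nullMeasurableSet]
    congr 1
    ext p
    have e : Real.cos δ • (Real.cos (i * δ) • p.1 + Real.sin (i * δ) • p.2)
        + Real.sin δ • (-Real.sin (i * δ) • p.1 + Real.cos (i * δ) • p.2)
        = Real.cos ((i + 1 : ℕ) * δ) • p.1 + Real.sin ((i + 1 : ℕ) * δ) • p.2 := by
      rw [Nat.cast_succ, add_mul, one_mul, Real.cos_add, Real.sin_add]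
      module
    simp only [Set.mem_preimage, Set.mem_ofPred_eq, e]
  have hsub : K ×ˢ Kᶜ ⊆ ⋃ i ∈ Finset.range N,
      {p : E × E | Real.cos (i * δ) • p.1 + Real.sin (i * δ) • p.2 ∈ K ∧
        Real.cos ((i + 1 : ℕ) * δ) • p.1 + Real.sin ((i + 1 : ℕ) * δ) • p.2 ∉ K} := by
    intro p hp
    by_contra hcon
    simp only [Set.mem_iUnion, Finset.mem_range, Set.mem_ofPred_eq, not_exists, not_and,
      not_not] at hcon
    have hall : ∀ i : ℕ, i ≤ N → Real.cos (i * δ) • p.1 + Real.sin (i * δ) • p.2 ∈ K := by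
      intro i
      induction i with
      | zero => intro _; simpa using hp.1
      | succ i ih => intro hi; exact hcon i (by omega) (ih (by omega))
    have := hall N le_rfl
    rw [hδ] at this
    simp at this
    exact hp.2 this
  calc (μ.prod μ) (K ×ˢ Kᶜ) ≤ _ := measure_mono hsub
    _ ≤ ∑ i ∈ Finset.range N, _ := measure_biUnion_finset_le _ _
    _ = _ := by simp only [hrot, hswap, Finset.sum_const, Finset.card_range, nsmul_eq_mul]

end Isoperimetry

section Expansion

variable {n : ℕ} {K : Set (EuclideanSpace ℝ (Fin n))}

lemma measureReal_slice_le (hK : Convex ℝ K) (hKc : IsClosed K) {w : ℝ} (hw : 0 < w)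
    (hball : Metric.closedBall (0 : EuclideanSpace ℝ (Fin n)) w ⊆ K) {δ : ℝ} (hδ : 0 ≤ δ)
    (hδ1 : δ ≤ 1) (g : ℝ) :
    (ProbabilityTheory.stdGaussian (EuclideanSpace ℝ (Fin n))).real
        {z | z ∉ K ∧ Real.cos δ * gauge K z ≤ 1 + Real.sin δ * |g| / w}
      ≤ (δ ^ 2 + 2 * (δ * |g| / w)) * |∫ x in K, (‖x‖ ^ 2 - (n : ℝ))
            ∂(ProbabilityTheory.stdGaussian (EuclideanSpace ℝ (Fin n)))|
        + (δ ^ 2 + 2 * (δ * |g| / w)) ^ 2 * (1 + Real.exp n * (n * varSq)) := by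
  have hnhds : K ∈ nhds (0 : EuclideanSpace ℝ (Fin n)) :=
    Filter.mem_of_superset (Metric.closedBall_mem_nhds 0 hw) hball
  have h0K := mem_of_mem_nhds hnhds
  set u := δ * |g| / w with hu
  have hu0 : 0 ≤ u := by positivity
  set b := δ ^ 2 + 2 * u with hb
  have hb0 : 0 ≤ b := by positivity
  refine le_trans ?_ (stdGaussian_real_dilate_sub_le hKc.measurableSet hb0)
  have hsub : K ⊆ {z | Real.exp (-b) • z ∈ K} := fun z hz =>
    hK.smul_mem_of_zero_mem h0K hz ⟨Real.exp_nonneg _, Real.exp_le_one_iff.2 (by linarith)⟩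
  rw [← measureReal_sdiff hsub hKc.measurableSet]
  refine measureReal_mono ?_
  rintro z ⟨hzK, hz⟩
  refine ⟨?_, hzK⟩
  change Real.exp (-b) • z ∈ K
  have hG := gauge_nonneg (s := K) z
  rw [← hKc.closure_eq, ← gauge_le_one_iff_mem_closure hK hnhds,
    gauge_smul_of_nonneg (Real.exp_nonneg _), smul_eq_mul, Real.exp_neg,
    inv_mul_le_iff₀ (Real.exp_pos _), mul_one]
  refine le_trans ?_ (Real.add_one_le_exp b)
  have hs : Real.sin δ * |g| / w ≤ u := by
    rw [hu]; gcongr; exact Real.sin_le hδ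
  have hc := mul_le_mul_of_nonneg_right (Real.one_sub_sq_div_two_le_cos (x := δ)) hG
  have h1 : (1 - δ ^ 2 / 2) * gauge K z ≤ 1 + u := by linarith
  have h2 := mul_le_mul_of_nonneg_left h1 (by positivity : 0 ≤ 1 + δ ^ 2)
  have hd : δ ^ 2 ≤ 1 := pow_le_one₀ hδ hδ1
  have h3 : 0 ≤ δ ^ 2 * (1 - δ ^ 2) * gauge K z :=
    mul_nonneg (mul_nonneg (sq_nonneg _) (by linarith)) hG
  have h4 := mul_le_mul_of_nonneg_right hd hu0
  nlinarith

/-- The probability that a small rotation brings a Gaussian vector into a convex body. -/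
lemma measure_prod_enter_le (hK : Convex ℝ K) (hKc : IsClosed K) {w : ℝ} (hw : 0 < w)
    (hball : Metric.closedBall (0 : EuclideanSpace ℝ (Fin n)) w ⊆ K) {δ : ℝ} (hδ : 0 ≤ δ)
    (hδ1 : δ ≤ 1) :
    ((ProbabilityTheory.stdGaussian (EuclideanSpace ℝ (Fin n))).prod
        (ProbabilityTheory.stdGaussian (EuclideanSpace ℝ (Fin n))))
        {p | p.1 ∉ K ∧ Real.cos δ • p.1 + Real.sin δ • p.2 ∈ K}
      ≤ ENNReal.ofReal (|∫ x in K, (‖x‖ ^ 2 - (n : ℝ))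
            ∂(ProbabilityTheory.stdGaussian (EuclideanSpace ℝ (Fin n)))| * (δ ^ 2 + 2 * δ / w)
          + (1 + Real.exp n * (n * varSq)) * δ ^ 2 * (2 + 8 / w ^ 2)) := by
  set μ := ProbabilityTheory.stdGaussian (EuclideanSpace ℝ (Fin n)) with hμ
  set A := |∫ x in K, (‖x‖ ^ 2 - (n : ℝ)) ∂μ| with hA
  have hA0 : 0 ≤ A := abs_nonneg _
  set B := 1 + Real.exp n * (n * varSq) with hB
  have hV : 0 ≤ varSq := variance_nonneg _ _
  have hB0 : 0 ≤ B := by positivity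
  have hnhds : K ∈ nhds (0 : EuclideanSpace ℝ (Fin n)) :=
    Filter.mem_of_superset (Metric.closedBall_mem_nhds 0 hw) hball
  have hgauge := continuous_gauge hK hnhds
  have hs0 : 0 ≤ Real.sin δ :=
    Real.sin_nonneg_of_nonneg_of_le_pi hδ (by linarith [Real.pi_gt_three])
  have hS : MeasurableSet {p : EuclideanSpace ℝ (Fin n) × EuclideanSpace ℝ (Fin n) |
      p.1 ∉ K ∧ Real.cos δ • p.1 + Real.sin δ • p.2 ∈ K} :=
    (hKc.measurableSet.compl.preimage measurable_fst).inter
      (hKc.measurableSet.preimage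
        (f := fun p : EuclideanSpace ℝ (Fin n) × EuclideanSpace ℝ (Fin n) =>
          Real.cos δ • p.1 + Real.sin δ • p.2) (by fun_prop))
  have hT : MeasurableSet {p : EuclideanSpace ℝ (Fin n) × ℝ |
      p.1 ∉ K ∧ Real.cos δ * gauge K p.1 ≤ 1 + Real.sin δ * |p.2| / w} :=
    (hKc.measurableSet.compl.preimage measurable_fst).inter
      (measurableSet_le
        ((hgauge.measurable.comp measurable_fst).const_mul (Real.cos δ))
        (g := fun p : EuclideanSpace ℝ (Fin n) × ℝ => 1 + Real.sin δ * |p.2| / w) (by fun_prop))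
  have hgi : Integrable (fun g : ℝ => g ^ 2) (gaussianReal 0 1) :=
    memLp_sq_gaussianReal.integrable (by norm_num)
  have hint : Integrable (fun g : ℝ => (A * (δ ^ 2 + δ / w) + B * δ ^ 2 * 2)
      + (A * (δ / w) + B * δ ^ 2 * (8 / w ^ 2)) * g ^ 2) (gaussianReal 0 1) :=
    (integrable_const _).add (hgi.const_mul _)
  calc (μ.prod μ) {p | p.1 ∉ K ∧ Real.cos δ • p.1 + Real.sin δ • p.2 ∈ K}
      = ∫⁻ z, μ {y | z ∉ K ∧ Real.cos δ • z + Real.sin δ • y ∈ K} ∂μ := Measure.prod_apply hS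
    _ ≤ ∫⁻ z, gaussianReal 0 1
          {g | z ∉ K ∧ Real.cos δ * gauge K z ≤ 1 + Real.sin δ * |g| / w} ∂μ := by
        refine lintegral_mono fun z => ?_
        by_cases hz : z ∈ K
        · simp [hz]
        · simp only [hz, not_false_eq_true, true_and]
          refine measure_step_le hK hw hball ?_ _ hs0
          by_contra! h
          refine hz ?_
          rw [← hKc.closure_eq, ← gauge_le_one_iff_mem_closure hK hnhds]
          exact h.le
    _ = (μ.prod (gaussianReal 0 1)) {p : EuclideanSpace ℝ (Fin n) × ℝ |
          p.1 ∉ K ∧ Real.cos δ * gauge K p.1 ≤ 1 + Real.sin δ * |p.2| / w} :=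
        (Measure.prod_apply hT).symm
    _ = ∫⁻ g, μ {z | z ∉ K ∧ Real.cos δ * gauge K z ≤ 1 + Real.sin δ * |g| / w}
          ∂(gaussianReal 0 1) := Measure.prod_apply_symm hT
    _ ≤ ∫⁻ g, ENNReal.ofReal ((A * (δ ^ 2 + δ / w) + B * δ ^ 2 * 2)
          + (A * (δ / w) + B * δ ^ 2 * (8 / w ^ 2)) * g ^ 2) ∂(gaussianReal 0 1) := by
        refine lintegral_mono fun g => ?_
        rw [← ofReal_measureReal]
        refine ENNReal.ofReal_le_ofReal ?_
        refine (measureReal_slice_le hK hKc hw hball hδ hδ1 g).trans ?_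
        have e1 : δ ^ 2 + 2 * (δ * |g| / w) ≤ δ ^ 2 + δ / w + δ / w * g ^ 2 := by
          have h1 : 2 * |g| ≤ 1 + g ^ 2 := by nlinarith [sq_nonneg (|g| - 1), sq_abs g]
          have h2 := mul_le_mul_of_nonneg_left h1 (by positivity : 0 ≤ δ / w)
          have h3 : 2 * (δ * |g| / w) = δ / w * (2 * |g|) := by ring
          linarith
        have e2 : (δ ^ 2 + 2 * (δ * |g| / w)) ^ 2 ≤ δ ^ 2 * 2 + δ ^ 2 * (8 / w ^ 2) * g ^ 2 := by
          have h1 : (δ ^ 2 + 2 * (δ * |g| / w)) ^ 2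
              ≤ 2 * (δ ^ 2) ^ 2 + 2 * (2 * (δ * |g| / w)) ^ 2 := by
            nlinarith [sq_nonneg (δ ^ 2 - 2 * (δ * |g| / w))]
          have h2 : 2 * (2 * (δ * |g| / w)) ^ 2 = δ ^ 2 * (8 / w ^ 2) * g ^ 2 := by
            rw [mul_pow, div_pow, mul_pow, sq_abs]; ring
          have h3 : (δ ^ 2) ^ 2 ≤ δ ^ 2 := by
            have := pow_le_one₀ (n := 2) hδ hδ1
            nlinarith [sq_nonneg δ]
          linarith
        have h1 := mul_le_mul_of_nonneg_left e1 hA0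
        have h2 := mul_le_mul_of_nonneg_left e2 hB0
        linarith
    _ = ENNReal.ofReal (A * (δ ^ 2 + 2 * δ / w) + B * δ ^ 2 * (2 + 8 / w ^ 2)) := by
        rw [← ofReal_integral_eq_lintegral_ofReal hint
          (Filter.Eventually.of_forall fun g => by positivity),
          integral_add (integrable_const _) (hgi.const_mul _), integral_const_mul,
          integral_sq_gaussianReal]
        congr 1
        simp
        ring

/-- An isoperimetric inequality for convex bodies containing a ball around the origin, with the
surface measure replaced by the derivative of the Gaussian measure under dilation. -/
lemma measureReal_mul_one_sub_le (hK : Convex ℝ K) (hKc : IsClosed K) {w : ℝ} (hw : 0 < w)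
    (hball : Metric.closedBall (0 : EuclideanSpace ℝ (Fin n)) w ⊆ K) :
    (ProbabilityTheory.stdGaussian (EuclideanSpace ℝ (Fin n))).real K
        * (1 - (ProbabilityTheory.stdGaussian (EuclideanSpace ℝ (Fin n))).real K)
      ≤ Real.pi * |∫ x in K, (‖x‖ ^ 2 - (n : ℝ))
            ∂(ProbabilityTheory.stdGaussian (EuclideanSpace ℝ (Fin n)))| / w := by
  set μ := ProbabilityTheory.stdGaussian (EuclideanSpace ℝ (Fin n)) with hμ
  set A := |∫ x in K, (‖x‖ ^ 2 - (n : ℝ)) ∂μ| with hA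
  set B := 1 + Real.exp n * (n * varSq) with hB
  have hV : 0 ≤ varSq := variance_nonneg _ _
  have hlim : Filter.Tendsto (fun N : ℕ => Real.pi / 2 / N) Filter.atTop (nhds 0) :=
    tendsto_const_div_atTop_nhds_zero_nat _
  have hlim2 : Filter.Tendsto (fun N : ℕ => Real.pi / 2 *
      (A * (Real.pi / 2 / N + 2 / w) + B * (Real.pi / 2 / N) * (2 + 8 / w ^ 2)))
      Filter.atTop (nhds (Real.pi / 2 * (A * (0 + 2 / w) + B * 0 * (2 + 8 / w ^ 2)))) :=
    (((hlim.add_const _).const_mul _).add ((hlim.const_mul _).mul_const _)).const_mul _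
  have e : Real.pi / 2 * (A * (0 + 2 / w) + B * 0 * (2 + 8 / w ^ 2)) = Real.pi * A / w := by
    field_simp; ring
  rw [e] at hlim2
  refine ge_of_tendsto hlim2 ?_
  filter_upwards [Filter.eventually_ge_atTop 2] with N hN
  have hN2 : (2 : ℝ) ≤ N := by exact_mod_cast hN
  set δ := Real.pi / 2 / N with hδ
  have hNδ : N * δ = Real.pi / 2 := by rw [hδ]; field_simp
  have hδ0 : 0 ≤ δ := by positivity
  have hδ1 : δ ≤ 1 := by
    rw [hδ, div_le_one (by linarith)]; linarith [Real.pi_le_four]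
  have h := (measure_prod_compl_le K hKc.measurableSet N δ hNδ).trans
    (mul_le_mul_right (measure_prod_enter_le hK hKc hw hball hδ0 hδ1) _)
  rw [← hμ, ← hA, ← hB, Measure.prod_prod] at h
  have h2 := ENNReal.toReal_mono (ENNReal.mul_ne_top (by simp) (by simp)) h
  rw [ENNReal.toReal_mul, ENNReal.toReal_mul, ENNReal.toReal_ofReal (by positivity)] at h2
  have h3 : (μ Kᶜ).toReal = 1 - μ.real K := probReal_compl_eq_one_sub hKc.measurableSet
  rw [h3] at h2
  refine h2.trans_eq ?_
  simp only [ENNReal.toReal_natCast]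
  calc (N : ℝ) * (A * (δ ^ 2 + 2 * δ / w) + B * δ ^ 2 * (2 + 8 / w ^ 2))
      = N * δ * (A * (δ + 2 / w) + B * δ * (2 + 8 / w ^ 2)) := by ring
    _ = _ := by rw [hNδ]

end Expansion

section Stability

lemma gaussianReal_real_Ioc_le {a b : ℝ} (hab : a ≤ b) :
    (gaussianReal 0 1).real (Set.Ioc a b) ≤ 2 / 5 * (b - a) := by
  have hpdf : ∀ x, gaussianPDF 0 1 x ≤ ENNReal.ofReal (2 / 5) := fun x => by
    refine ENNReal.ofReal_le_ofReal ?_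
    have h1 : (5 / 2 : ℝ) ≤ √(2 * Real.pi) := by
      refine Real.le_sqrt_of_sq_le ?_
      linarith [Real.pi_gt_d2]
    have h2 : (√(2 * Real.pi))⁻¹ ≤ 2 / 5 := by
      rw [show (2 / 5 : ℝ) = (5 / 2)⁻¹ by norm_num]
      exact inv_anti₀ (by norm_num) h1
    have h3 : Real.exp (-x ^ 2 / 2) ≤ 1 := Real.exp_le_one_iff.2 (by nlinarith [sq_nonneg x])
    simp only [gaussianPDFReal, NNReal.coe_one, mul_one, sub_zero]
    calc _ ≤ (2 / 5 : ℝ) * 1 := mul_le_mul h2 h3 (Real.exp_nonneg _) (by norm_num)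
      _ = 2 / 5 := mul_one _
  have h : gaussianReal 0 1 (Set.Ioc a b) ≤ ENNReal.ofReal (2 / 5 * (b - a)) := by
    rw [gaussianReal_apply _ one_ne_zero]
    calc _ ≤ ∫⁻ _ in Set.Ioc a b, ENNReal.ofReal (2 / 5) := lintegral_mono hpdf
      _ = _ := by
        rw [lintegral_const, Measure.restrict_apply_univ, Real.volume_Ioc,
          ← ENNReal.ofReal_mul (by norm_num)]
  exact ENNReal.toReal_le_of_le_ofReal (mul_nonneg (by norm_num) (by linarith)) h

variable {E : Type*} [NormedAddCommGroup E] [InnerProductSpace ℝ E] [FiniteDimensional ℝ E]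

lemma exists_unit_inner_le {C : Set E} (hC : Convex ℝ C) (hCc : IsClosed C) (hne : C.Nonempty)
    {w : ℝ} (hball : ¬ Metric.closedBall (0 : E) w ⊆ C) :
    ∃ u : E, ‖u‖ = 1 ∧ ∀ x ∈ C, inner ℝ u x ≤ w := by
  obtain ⟨p, hp, hpC⟩ := Set.not_subset.1 hball
  rw [mem_closedBall_zero_iff] at hp
  obtain ⟨f, r, hfr, hrp⟩ := geometric_hahn_banach_closed_point hC hCc hpC
  set v := (InnerProductSpace.toDual ℝ E).symm f with hv
  have hfv : ∀ x, f x = inner ℝ v x := fun x => by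
    rw [hv, InnerProductSpace.toDual_symm_apply]
  have hv0 : v ≠ 0 := by
    intro h0
    obtain ⟨k, hk⟩ := hne
    have h1 := (hfr k hk).trans hrp
    simp [hfv, h0] at h1
  have hvn : 0 < ‖v‖ := norm_pos_iff.2 hv0
  refine ⟨‖v‖⁻¹ • v, by rw [norm_smul, norm_inv, norm_norm, inv_mul_cancel₀ hvn.ne'],
    fun x hx => ?_⟩
  have h1 := (hfr x hx).trans hrp
  rw [hfv, hfv] at h1
  have h2 : inner ℝ v p ≤ ‖v‖ * w :=
    (real_inner_le_norm v p).trans (mul_le_mul_of_nonneg_left hp hvn.le)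
  rw [real_inner_smul_left, inv_mul_le_iff₀ hvn]
  linarith

variable [MeasurableSpace E] [BorelSpace E]

/-- Eigenfunctions of the noise operator give lower bounds for the noise stability. -/
lemma sq_le_stab_mul {f g : E → ℝ} (hf : Measurable f) (hb : ∀ x, |f x| ≤ 1)
    (hg : MemLp g 2 (ProbabilityTheory.stdGaussian E)) {t : ℝ} (ht : 0 ≤ t) {l : ℝ}
    (hgl : ∀ x, noiseOp (Real.exp (-t / 2)) √(1 - Real.exp (-t)) g x = l * g x) :
    (l * ∫ x, f x * g x ∂(ProbabilityTheory.stdGaussian E)) ^ 2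
      ≤ (∫ x, f x * noiseOp (Real.exp (-t)) √(1 - Real.exp (-2 * t)) f x
          ∂(ProbabilityTheory.stdGaussian E))
        * ∫ x, g x ^ 2 ∂(ProbabilityTheory.stdGaussian E) := by
  have h1 : Real.exp (-t / 2) ^ 2 = Real.exp (-t) := by
    rw [← Real.exp_nat_mul]; congr 1; push_cast; ring
  have h2 : √(1 - Real.exp (-t)) ^ 2 = 1 - Real.exp (-t) :=
    Real.sq_sqrt (sub_nonneg.2 (Real.exp_le_one_iff.2 (by linarith)))
  have h3 : √(1 - Real.exp (-2 * t)) ^ 2 = 1 - Real.exp (-2 * t) :=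
    Real.sq_sqrt (sub_nonneg.2 (Real.exp_le_one_iff.2 (by linarith)))
  have h4 : Real.exp (-2 * t) = Real.exp (-t) ^ 2 := by
    rw [← Real.exp_nat_mul]; congr 1; push_cast; ring
  have := sq_le_noise_stability_mul hf hb hg (b := √(1 - Real.exp (-2 * t)))
    (by rw [h1, h2]; ring) (by rw [mul_pow, h1, h2, h3, h4]; ring) hgl
  rwa [h1] at this

lemma noiseOp_const (c s a : ℝ) (x : E) : noiseOp c s (fun _ => a) x = a := by
  simp [noiseOp]

lemma integral_inner_stdGaussian (u : E) :
    ∫ x, inner ℝ u x ∂(ProbabilityTheory.stdGaussian E) = 0 := by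
  have h := integral_map (μ := ProbabilityTheory.stdGaussian E) (φ := fun x => inner ℝ u x)
    (f := fun t : ℝ => t) (by fun_prop) (by fun_prop)
  rw [← h, map_inner_stdGaussian]
  exact integral_id_gaussianReal

lemma memLp_inner_stdGaussian (u : E) :
    MemLp (fun x => inner ℝ u x) 2 (ProbabilityTheory.stdGaussian E) := by
  have h := (memLp_id_gaussianReal' (μ := 0) (v := ‖u‖₊ ^ 2) 2 (by norm_num))
  rw [← map_inner_stdGaussian] at h
  exact h.comp_of_map (f := fun x => inner ℝ u x) (by fun_prop)

lemma integral_inner_sq_stdGaussian (u : E) (hu : ‖u‖ = 1) :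
    ∫ x, (inner ℝ u x : ℝ) ^ 2 ∂(ProbabilityTheory.stdGaussian E) = 1 := by
  have h := integral_map (μ := ProbabilityTheory.stdGaussian E) (φ := fun x => inner ℝ u x)
    (f := fun t : ℝ => t ^ 2) (by fun_prop) (by fun_prop)
  have hu' : ‖u‖₊ = 1 := NNReal.coe_injective (by simpa using hu)
  rw [← h, map_inner_stdGaussian, hu', one_pow, integral_sq_gaussianReal]

lemma noiseOp_inner (c s : ℝ) (u x : E) :
    noiseOp c s (fun z => inner ℝ u z) x = c * inner ℝ u x := by
  have hi : Integrable (fun y => inner ℝ u y) (ProbabilityTheory.stdGaussian E) :=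
    (memLp_inner_stdGaussian u).integrable (by norm_num)
  simp only [noiseOp, inner_add_right, real_inner_smul_right]
  rw [integral_add (integrable_const _) (hi.const_mul s), integral_const_mul s,
    integral_inner_stdGaussian]
  simp

lemma noiseOp_norm_sq_sub {n : ℕ} {c s : ℝ} (h : c ^ 2 + s ^ 2 = 1)
    (x : EuclideanSpace ℝ (Fin n)) :
    noiseOp c s (fun z => ‖z‖ ^ 2 - (n : ℝ)) x = c ^ 2 * (‖x‖ ^ 2 - n) := by
  have hi : Integrable (fun y => inner ℝ x y)
      (ProbabilityTheory.stdGaussian (EuclideanSpace ℝ (Fin n))) :=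
    (memLp_inner_stdGaussian x).integrable (by norm_num)
  have hL : Integrable (fun y => ‖y‖ ^ 2 - (n : ℝ))
      (ProbabilityTheory.stdGaussian (EuclideanSpace ℝ (Fin n))) :=
    (memLp_norm_sq n).integrable (by norm_num)
  have hL2 : Integrable (fun y => ‖y‖ ^ 2)
      (ProbabilityTheory.stdGaussian (EuclideanSpace ℝ (Fin n))) := by
    refine (hL.add (integrable_const (n : ℝ))).congr (Filter.Eventually.of_forall fun y => ?_)
    simp
  have e : ∀ y : EuclideanSpace ℝ (Fin n), ‖c • x + s • y‖ ^ 2 - (n : ℝ)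
      = (c ^ 2 * ‖x‖ ^ 2 - n) + (2 * c * s * inner ℝ x y + s ^ 2 * ‖y‖ ^ 2) := fun y => by
    rw [norm_add_sq_real, norm_smul, norm_smul, real_inner_smul_left, real_inner_smul_right,
      mul_pow, mul_pow, Real.norm_eq_abs, Real.norm_eq_abs, sq_abs, sq_abs]
    ring
  have hsum : Integrable (fun y => 2 * c * s * inner ℝ x y + s ^ 2 * ‖y‖ ^ 2)
      (ProbabilityTheory.stdGaussian (EuclideanSpace ℝ (Fin n))) :=
    (hi.const_mul _).add (hL2.const_mul _)
  simp only [noiseOp, e]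
  rw [integral_add (integrable_const _) hsum,
    integral_add (hi.const_mul _) (hL2.const_mul _), integral_const_mul, integral_const_mul,
    integral_inner_stdGaussian, integral_norm_sq]
  simp
  linear_combination (n : ℝ) * h

/-- A set of nearly half measure lying in a halfspace close to the origin has a large negative
first moment in the normal direction. -/
lemma setIntegral_inner_le {C : Set E} (hC : MeasurableSet C) {u : E} (hu : ‖u‖ = 1)
    (hle : ∀ x ∈ C, inner ℝ u x ≤ 1 / 10)
    (hm : 9 / 20 ≤ (ProbabilityTheory.stdGaussian E).real C) :
    ∫ x in C, inner ℝ u x ∂(ProbabilityTheory.stdGaussian E) ≤ -(7 / 100) := by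
  set μ := ProbabilityTheory.stdGaussian E with hμ
  have hi : Integrable (fun y => inner ℝ u y) μ :=
    (memLp_inner_stdGaussian u).integrable (by norm_num)
  have hX : Measurable fun x : E => (inner ℝ u x : ℝ) := by fun_prop
  set S := (fun x : E => (inner ℝ u x : ℝ)) ⁻¹' Set.Ioc (-(2 / 5)) (1 / 10) with hS
  have hSm : MeasurableSet S := hX measurableSet_Ioc
  have hu' : ‖u‖₊ = 1 := NNReal.coe_injective (by simpa using hu)
  have hSle : μ.real S ≤ 1 / 5 := by
    have h1 : μ.real S = (gaussianReal 0 1).real (Set.Ioc (-(2 / 5)) (1 / 10)) := by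
      rw [hS, ← map_measureReal_apply hX measurableSet_Ioc, hμ, map_inner_stdGaussian, hu', one_pow]
    rw [h1]
    refine (gaussianReal_real_Ioc_le (by norm_num)).trans (by norm_num)
  have h1 : μ.real C ≤ μ.real (C \ S) + μ.real S :=
    (measureReal_mono (by intro x hx; by_cases h : x ∈ S <;> simp [h, hx])).trans
      (measureReal_union_le _ _)
  have hint : IntegrableOn (fun x => 1 / 10 - (inner ℝ u x : ℝ)) C μ :=
    ((integrable_const _).sub hi).integrableOn
  have h2 : ∫ _ in C \ S, (1 / 2 : ℝ) ∂μ ≤ ∫ x in C \ S, (1 / 10 - (inner ℝ u x : ℝ)) ∂μ := by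
    refine setIntegral_mono_on (integrable_const _).integrableOn
      (hint.mono_set Set.sdiff_subset) (hC.diff hSm) ?_
    rintro x ⟨hxC, hxS⟩
    have hx1 := hle x hxC
    have : (inner ℝ u x : ℝ) ≤ -(2 / 5) := by
      by_contra! h
      exact hxS ⟨h, hx1⟩
    linarith
  have h3 : ∫ x in C \ S, (1 / 10 - (inner ℝ u x : ℝ)) ∂μ
      ≤ ∫ x in C, (1 / 10 - (inner ℝ u x : ℝ)) ∂μ := by
    refine setIntegral_mono_set hint ?_ Set.sdiff_subset.eventuallyLE
    filter_upwards [ae_restrict_mem hC] with x hx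
    exact sub_nonneg.2 (hle x hx)
  have h4 := h2.trans h3
  rw [integral_sub (integrable_const _).integrableOn hi.integrableOn, setIntegral_const,
    setIntegral_const, smul_eq_mul, smul_eq_mul] at h4
  linarith

variable {n : ℕ}

lemma abs_pmInd_le (C : Set (EuclideanSpace ℝ (Fin n))) (x : EuclideanSpace ℝ (Fin n)) :
    |pmInd C x| ≤ 1 := by
  unfold pmInd; split_ifs <;> simp

lemma pmInd_eq_indicator (C : Set (EuclideanSpace ℝ (Fin n))) :
    pmInd C = fun x => 2 * C.indicator 1 x - 1 := by
  ext x
  by_cases h : x ∈ C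
  · simp [pmInd, h]; norm_num
  · simp [pmInd, h]

lemma measurable_pmInd {C : Set (EuclideanSpace ℝ (Fin n))} (hC : MeasurableSet C) :
    Measurable (pmInd C) := by
  rw [pmInd_eq_indicator]
  exact ((measurable_one.indicator hC).const_mul 2).sub_const 1

lemma integral_pmInd_mul {C : Set (EuclideanSpace ℝ (Fin n))} (hC : MeasurableSet C)
    {μ : Measure (EuclideanSpace ℝ (Fin n))} {g : EuclideanSpace ℝ (Fin n) → ℝ}
    (hg : Integrable g μ) :
    ∫ x, pmInd C x * g x ∂μ = 2 * ∫ x in C, g x ∂μ - ∫ x, g x ∂μ := by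
  rw [← integral_indicator hC, ← integral_const_mul,
    ← integral_sub ((hg.indicator hC).const_mul 2) hg]
  refine integral_congr_ae (Filter.Eventually.of_forall fun x => ?_)
  by_cases h : x ∈ C
  · simp [pmInd, h]; ring
  · simp [pmInd, h]

lemma stab_closed_convex_ge {C : Set (EuclideanSpace ℝ (Fin n))} (hC : Convex ℝ C)
    (hCc : IsClosed C) (hn : 1 ≤ n) {t : ℝ} (ht : 0 ≤ t) :
    1 / (10000 * (varSq + 1)) * Real.exp (-2 * t) / n
      ≤ ∫ x, pmInd C x * noiseOp (Real.exp (-t)) √(1 - Real.exp (-2 * t)) (pmInd C) x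
          ∂(ProbabilityTheory.stdGaussian (EuclideanSpace ℝ (Fin n))) := by
  set μ := ProbabilityTheory.stdGaussian (EuclideanSpace ℝ (Fin n)) with hμ
  set S := ∫ x, pmInd C x * noiseOp (Real.exp (-t)) √(1 - Real.exp (-2 * t)) (pmInd C) x ∂μ
    with hS
  have hV : 0 ≤ varSq := variance_nonneg _ _
  have hn1 : (1 : ℝ) ≤ n := by exact_mod_cast hn
  have hexp2 : Real.exp (-2 * t) = Real.exp (-t) ^ 2 := by
    rw [← Real.exp_nat_mul]; congr 1; push_cast; ring
  have hexp_half : Real.exp (-t / 2) ^ 2 = Real.exp (-t) := by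
    rw [← Real.exp_nat_mul]; congr 1; push_cast; ring
  have he1 : Real.exp (-t) ≤ 1 := Real.exp_le_one_iff.2 (by linarith)
  have he0 := Real.exp_pos (-t)
  have he2 : Real.exp (-2 * t) ≤ Real.exp (-t) := by rw [hexp2]; nlinarith
  have hs : √(1 - Real.exp (-t)) ^ 2 = 1 - Real.exp (-t) := Real.sq_sqrt (by linarith)
  have hfm := measurable_pmInd hCc.measurableSet
  have hf1 := abs_pmInd_le C
  have hm := integral_pmInd_mul hCc.measurableSet (integrable_const (1 : ℝ)) (μ := μ)
  have h1 := sq_le_stab_mul hfm hf1 (memLp_const (1 : ℝ)) ht (l := 1)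
    (fun x => by rw [noiseOp_const, mul_one])
  rw [← hμ, hm, ← hS] at h1
  simp only [integral_const, measureReal_restrict_apply_univ, probReal_univ, smul_eq_mul,
    mul_one, one_pow, one_mul] at h1
  have hS0 : 0 ≤ S := (sq_nonneg _).trans h1
  have hSn : S ≤ S * (n * (varSq + 1)) :=
    le_mul_of_one_le_right hS0 (one_le_mul_of_one_le_of_one_le hn1 (by linarith))
  have e : 1 / (10000 * (varSq + 1)) * Real.exp (-2 * t) / n
      = (1 / 10000 * Real.exp (-2 * t)) / (n * (varSq + 1)) := by
    field_simp
  rw [e, div_le_iff₀ (by positivity)]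
  by_cases hfar : (1 / 100 : ℝ) ≤ (2 * μ.real C - 1) ^ 2
  · linarith
  push Not at hfar
  have hm1 : 9 / 20 ≤ μ.real C := by nlinarith
  have hm2 : μ.real C ≤ 11 / 20 := by nlinarith
  by_cases hball : Metric.closedBall (0 : EuclideanSpace ℝ (Fin n)) (1 / 10) ⊆ C
  · have hiso := measureReal_mul_one_sub_le hC hCc (by norm_num) hball
    have h2 := sq_le_stab_mul hfm hf1 (memLp_norm_sq n) ht (l := Real.exp (-t))
      (fun x => by rw [noiseOp_norm_sq_sub (by rw [hexp_half, hs]; ring), hexp_half])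
    have hgi : Integrable (fun x => ‖x‖ ^ 2 - (n : ℝ)) μ :=
      (memLp_norm_sq n).integrable (by norm_num)
    have hzero : ∫ x, (‖x‖ ^ 2 - (n : ℝ)) ∂μ = 0 := by
      have h3 := noiseOp_norm_sq_sub (n := n) (c := 0) (s := 1) (by norm_num) 0
      simpa [noiseOp] using h3
    rw [integral_pmInd_mul hCc.measurableSet hgi, hzero, integral_norm_sq_sub_sq, sub_zero,
      ← hS] at h2
    rw [← hμ] at hiso
    set A := ∫ x in C, (‖x‖ ^ 2 - (n : ℝ)) ∂μ with hA
    have h3 : 6 / 1000 ≤ |A| := by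
      have h4 : Real.pi * |A| ≤ 4 * |A| :=
        mul_le_mul_of_nonneg_right Real.pi_le_four (abs_nonneg _)
      have h5 : 24 / 100 ≤ μ.real C * (1 - μ.real C) := by nlinarith
      have h6 : Real.pi * |A| / (1 / 10) = 10 * (Real.pi * |A|) := by ring
      linarith
    have h4 : (6 / 1000) ^ 2 ≤ A ^ 2 := by
      rw [← sq_abs A]; exact pow_le_pow_left₀ (by norm_num) h3 2
    have h5 : (Real.exp (-t) * (2 * A)) ^ 2 = 4 * A ^ 2 * Real.exp (-2 * t) := by
      rw [hexp2]; ring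
    have h6 := mul_le_mul_of_nonneg_right h4 (Real.exp_nonneg (-2 * t))
    have h7 : S * (n * varSq) ≤ S * (n * (varSq + 1)) := by
      gcongr; linarith
    nlinarith [Real.exp_nonneg (-2 * t)]
  · have hne : C.Nonempty := by
      by_contra! h
      rw [h] at hm1
      norm_num at hm1
    obtain ⟨u, hu, hle⟩ := exists_unit_inner_le hC hCc hne hball
    have h2 := sq_le_stab_mul hfm hf1 (memLp_inner_stdGaussian u) ht (l := Real.exp (-t / 2))
      (fun x => noiseOp_inner _ _ _ _)
    rw [integral_pmInd_mul hCc.measurableSet ((memLp_inner_stdGaussian u).integrable (by norm_num)),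
      integral_inner_stdGaussian, integral_inner_sq_stdGaussian u hu, sub_zero, ← hS, mul_one,
      mul_pow, hexp_half] at h2
    have h3 := setIntegral_inner_le hCc.measurableSet hu hle hm1
    have h4 : (1 / 100 : ℝ) ≤ (2 * ∫ x in C, inner ℝ u x ∂μ) ^ 2 := by nlinarith
    have h5 := mul_le_mul_of_nonneg_left h4 he0.le
    linarith

/-- Noise stability does not distinguish a convex set from its closure. -/
lemma gaussianNoiseStab_eq_closure {K : Set (EuclideanSpace ℝ (Fin n))} (hK : Convex ℝ K) {t : ℝ}
    (ht : 0 ≤ t) :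
    gaussianNoiseStab n (pmInd K) t
      = ∫ x, pmInd (closure K) x
          * noiseOp (Real.exp (-t)) √(1 - Real.exp (-2 * t)) (pmInd (closure K)) x
          ∂(ProbabilityTheory.stdGaussian (EuclideanSpace ℝ (Fin n))) := by
  have hae : ∀ᵐ x ∂(ProbabilityTheory.stdGaussian (EuclideanSpace ℝ (Fin n))),
      pmInd K x = pmInd (closure K) x := by
    refine stdGaussian_absolutelyContinuous.ae_le ?_
    filter_upwards [measure_eq_zero_iff_ae_notMem.1 (hK.addHaar_frontier volume)] with x hx
    by_cases h : x ∈ K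
    · simp [pmInd, h, subset_closure h]
    · have : x ∉ closure K := fun hc => hx ⟨hc, fun hi => h (interior_subset hi)⟩
      simp [pmInd, h, this]
  have hcs : Real.exp (-t) ^ 2 + √(1 - Real.exp (-2 * t)) ^ 2 = 1 := by
    rw [Real.sq_sqrt (sub_nonneg.2 (Real.exp_le_one_iff.2 (by linarith))), ← Real.exp_nat_mul]
    push_cast
    ring_nf
  have hprod := Measure.ae_ae_of_ae_prod
    ((measurePreserving_combination hcs).quasiMeasurePreserving.ae hae)
  rw [gaussianNoiseStab, stdGaussian_eq_stdGaussian]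
  refine integral_congr_ae ?_
  filter_upwards [hae, hprod] with x hx hy
  rw [integral_const_mul, hx, noiseOp]
  congr 1
  exact integral_congr_ae hy

end Stability

/-- Noise stability lower bounds for convex sets at all noise rates: every convex set
satisfies `Stab_t(K) ≥ c·e^{-2t}/n²`, and every centrally symmetric convex set
satisfies `Stab_t(K) ≥ c·e^{-2t}/n`. -/
theorem noise_stability_convex :
    ∃ c : ℝ, 0 < c ∧ ∃ n₀ : ℕ, ∀ n : ℕ, n₀ ≤ n →
      ∀ t : ℝ, 0 ≤ t →
        ∀ K : Set (EuclideanSpace ℝ (Fin n)),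
          Convex ℝ K →
          (c * Real.exp (-2 * t) / (n : ℝ) ^ 2 ≤ gaussianNoiseStab n (pmInd K) t) ∧
          ((∀ x, x ∈ K ↔ -x ∈ K) →
            c * Real.exp (-2 * t) / (n : ℝ) ≤ gaussianNoiseStab n (pmInd K) t) := by
  have hV : 0 ≤ varSq := variance_nonneg _ _
  refine ⟨1 / (10000 * (varSq + 1)), by positivity, 1, fun n hn t ht K hK => ?_⟩
  have hn1 : (1 : ℝ) ≤ n := by exact_mod_cast hn
  have h : 1 / (10000 * (varSq + 1)) * Real.exp (-2 * t) / (n : ℝ)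
      ≤ gaussianNoiseStab n (pmInd K) t := by
    rw [gaussianNoiseStab_eq_closure hK ht]
    exact stab_closed_convex_ge hK.closure isClosed_closure hn ht
  refine ⟨le_trans ?_ h, fun _ => h⟩
  exact div_le_div_of_nonneg_left (by positivity) (by linarith) (le_self_pow₀ hn1 two_ne_zero)
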